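/- The exponential of an ℝ≥0∞-weighted relation is multiplicative over multiset sums (naturality of the comultiplication δ, underlying preservation of promotion): let α : X → Y → ℝ≥0∞ and let Fα : Multiset X → Multiset Y → ℝ≥0∞ satisfy Fα μ (↑ys) = S(α, μ, ys) for all μ : Multiset X and ys : List Y. Then for every μ : Multiset X and every list of multisets L : List (Multiset Y), Fα μ (L.sum) = ∑' (ms : {l : List (Multiset X) // l.length = L.length ∧ l.sum = μ}), ∏ i : Fin L.length, Fα (the i-th entry of ms) (L.get i). -/

import Mathlib

open scoped ENNReal

/-- The exponential coefficient `S(α, μ, ys)` of a weighted relation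
`α : X → Y → ℝ≥0∞` at a multiset `μ : Multiset X` and a list `ys : List Y`. -/
noncomputable def expCoeff {X Y : Type*} (α : X → Y → ℝ≥0∞)
    (μ : Multiset X) (ys : List Y) : ℝ≥0∞ :=
  ∑' xs : {l : List X // l.length = ys.length ∧ (↑l : Multiset X) = μ},
    ∏ i : Fin ys.length, α (xs.1.get (Fin.cast xs.2.1.symm i)) (ys.get i)

/-- The product of the weights `α x y` along two lists of the same length, and `0` if the lengths
differ. -/
noncomputable def listWeight {X Y : Type*} (α : X → Y → ℝ≥0∞) : List X → List Y → ℝ≥0∞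
  | [], [] => 1
  | x :: xs, y :: ys => α x y * listWeight α xs ys
  | [], _ :: _ => 0
  | _ :: _, [] => 0

section listWeight

variable {X Y : Type*} (α : X → Y → ℝ≥0∞)

theorem listWeight_eq_zero_of_length_ne (xs : List X) (ys : List Y)
    (h : xs.length ≠ ys.length) : listWeight α xs ys = 0 := by
  induction xs generalizing ys with
  | nil => cases ys <;> simp_all [listWeight]
  | cons x xs ih => cases ys <;> simp_all [listWeight]

theorem listWeight_eq_prod (xs : List X) (ys : List Y) (h : xs.length = ys.length) :
    listWeight α xs ys = ∏ i : Fin ys.length, α (xs.get (Fin.cast h.symm i)) (ys.get i) := by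
  induction xs generalizing ys with
  | nil =>
    cases ys with
    | nil => simp [listWeight]
    | cons y ys => simp at h
  | cons x xs ih =>
    cases ys with
    | nil => simp at h
    | cons y ys =>
      rw [listWeight, ih ys (by simpa using h)]
      exact (Fin.prod_univ_succ (n := ys.length)
        fun i => α ((x :: xs).get (Fin.cast h.symm i)) ((y :: ys).get i)).symm

theorem tsum_prod_eq_tsum_listWeight (ys : List Y) (P : List X → Prop) [DecidablePred P] :
    ∑' xs : {l : List X // l.length = ys.length ∧ P l},
        ∏ i : Fin ys.length, α (xs.1.get (Fin.cast xs.2.1.symm i)) (ys.get i)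
      = ∑' l : List X, listWeight α l ys * if P l then 1 else 0 := by
  calc
    _ = ∑' xs : {l : List X | l.length = ys.length ∧ P l}, listWeight α xs ys :=
      tsum_congr fun xs => (listWeight_eq_prod α xs.1 ys xs.2.1).symm
    _ = _ := by
      rw [tsum_subtype {l : List X | l.length = ys.length ∧ P l} fun l => listWeight α l ys]
      refine tsum_congr fun l => ?_
      by_cases hl : l.length = ys.length
      · by_cases hP : P l <;> simp [hl, hP]
      · simp [hl, listWeight_eq_zero_of_length_ne α l ys hl]

theorem tsum_listWeight_nil_mul (h : List X → ℝ≥0∞) :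
    ∑' l, listWeight α l [] * h l = h [] := by
  rw [tsum_eq_single []]
  · simp [listWeight]
  · intro l hl
    cases l <;> simp_all [listWeight]

theorem tsum_listWeight_cons_mul (y : Y) (ys : List Y) (h : List X → ℝ≥0∞) :
    ∑' l, listWeight α l (y :: ys) * h l
      = ∑' a, α a y * ∑' l, listWeight α l ys * h (a :: l) := by
  have hinj : Function.Injective fun p : X × List X => p.1 :: p.2 := by
    rintro ⟨a, l⟩ ⟨b, m⟩ hab
    simpa using hab
  rw [← hinj.tsum_eq]
  · simp only [listWeight, mul_assoc, ← ENNReal.tsum_mul_left]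
    exact ENNReal.tsum_prod (f := fun a l => α a y * (listWeight α l ys * h (a :: l)))
  · intro l hl
    cases l with
    | nil => simp [listWeight] at hl
    | cons a l => exact ⟨(a, l), rfl⟩

theorem tsum_listWeight_append_mul (ys zs : List Y) (h : List X → ℝ≥0∞) :
    ∑' l, listWeight α l (ys ++ zs) * h l
      = ∑' l, listWeight α l ys * ∑' m, listWeight α m zs * h (l ++ m) := by
  induction ys generalizing h with
  | nil => simp [tsum_listWeight_nil_mul]
  | cons y ys ih => simp [tsum_listWeight_cons_mul, ih]

theorem expCoeff_eq_tsum_listWeight [DecidableEq X] (μ : Multiset X) (ys : List Y) :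
    expCoeff α μ ys
      = ∑' l : List X, listWeight α l ys * if (↑l : Multiset X) = μ then 1 else 0 :=
  tsum_prod_eq_tsum_listWeight α ys fun l => (↑l : Multiset X) = μ

theorem tsum_expCoeff_mul (ys : List Y) (h : Multiset X → ℝ≥0∞) :
    ∑' μ, expCoeff α μ ys * h μ = ∑' l : List X, listWeight α l ys * h ↑l := by
  classical
  simp only [expCoeff_eq_tsum_listWeight, ← ENNReal.tsum_mul_right]
  rw [ENNReal.tsum_comm]
  refine tsum_congr fun l => ?_
  rw [tsum_eq_single (↑l : Multiset X)]
  · simp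
  · intro μ hμ
    simp [hμ.symm]

theorem exists_tsum_listWeight_sum_eq (Fα : Multiset X → Multiset Y → ℝ≥0∞)
    (hFα : ∀ (μ : Multiset X) (ys : List Y), Fα μ (↑ys) = expCoeff α μ ys)
    (L : List (Multiset Y)) :
    ∃ zs : List Y, (↑zs : Multiset Y) = L.sum ∧ ∀ h : Multiset X → ℝ≥0∞,
      ∑' ms : List (Multiset X), listWeight Fα ms L * h ms.sum
        = ∑' l : List X, listWeight α l zs * h ↑l := by
  induction L with
  | nil => exact ⟨[], rfl, fun h => by
      rw [tsum_listWeight_nil_mul Fα fun ms => h ms.sum,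
        tsum_listWeight_nil_mul α fun l => h ↑l]
      rfl⟩
  | cons ν L ih =>
    obtain ⟨zs, hzs, ih⟩ := ih
    obtain ⟨ys, rfl⟩ : ∃ ys : List Y, ↑ys = ν := Quot.exists_rep ν
    refine ⟨ys ++ zs, by rw [List.sum_cons, ← hzs]; rfl, fun h => ?_⟩
    rw [tsum_listWeight_cons_mul Fα _ L fun ms => h ms.sum,
      tsum_listWeight_append_mul α ys zs fun l => h ↑l]
    simp only [List.sum_cons, ← Multiset.coe_add]
    rw [← tsum_expCoeff_mul α ys fun a => ∑' m : List X, listWeight α m zs * h (a + ↑m)]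
    refine tsum_congr fun a => ?_
    rw [ih fun m => h (a + m), ← hFα]

end listWeight

/-- The exponential of a weighted relation is multiplicative over multiset sums
(naturality of the comultiplication `δ`): for `Fα = !α`,
`(!α) μ (ν₁ + ⋯ + νₙ) = Σ_{μ = μ₁ + ⋯ + μₙ} Π (!α) μᵢ νᵢ`. -/
theorem expCoeff_sum_decomposition {X Y : Type*}
    (α : X → Y → ℝ≥0∞) (Fα : Multiset X → Multiset Y → ℝ≥0∞)
    (hFα : ∀ (μ : Multiset X) (ys : List Y), Fα μ (↑ys) = expCoeff α μ ys)
    (μ : Multiset X) (L : List (Multiset Y)) :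
    Fα μ L.sum
      = ∑' ms : {l : List (Multiset X) // l.length = L.length ∧ l.sum = μ},
          ∏ i : Fin L.length, Fα (ms.1.get (Fin.cast ms.2.1.symm i)) (L.get i) := by
  classical
  obtain ⟨zs, hzs, h⟩ := exists_tsum_listWeight_sum_eq α Fα hFα L
  rw [← hzs, hFα, expCoeff_eq_tsum_listWeight,
    tsum_prod_eq_tsum_listWeight Fα L fun l => l.sum = μ]
  exact (h fun m => if m = μ then 1 else 0).symm
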